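/- The Dirichlet form ℰ₂(u,u) = ⟨u, (I − P²)u⟩_π satisfies the identity ℰ₂(u,u) = 2‖∇u‖²_{L²} − Σ_{k∈ℤ} ω_k (Δu(k))² for all u ∈ L²(π). Consequently, if ℰ̃₂ denotes the corresponding Dirichlet form for the homogeneous environment ω̃_k = 1/2 for all k, then ℰ̃₂(u,u) ≤ ℰ₂(u,u) for all u ∈ L²(π). -/

import Mathlib

open Filter MeasureTheory Topology

/-- `(P^n)_{k,j}` for the balanced walk on `ℤ` with transition probabilities
`P_{k,k-1} = P_{k,k+1} = ω k`, `P_{k,k} = 1 - 2 ω k`. -/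
noncomputable def Ppow (ω : ℤ → ℝ) : ℕ → ℤ → ℤ → ℝ
  | 0, k, j => if k = j then 1 else 0
  | n + 1, k, j =>
      ω k * Ppow ω n (k - 1) j + (1 - 2 * ω k) * Ppow ω n k j + ω k * Ppow ω n (k + 1) j

/-- The operator `P` acting on functions `u : ℤ → ℝ`, for the environment `ω`. -/
noncomputable def Pop (ω : ℤ → ℝ) (u : ℤ → ℝ) (k : ℤ) : ℝ :=
  ω k * u (k - 1) + (1 - 2 * ω k) * u k + ω k * u (k + 1)

/-- The Dirichlet form `ℰ₂(u,u) = ⟨u, (I - P²)u⟩_π` for the environment `ω`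
(with `π_k = 1/ω_k`). -/
noncomputable def dirichlet2 (ω : ℤ → ℝ) (u : ℤ → ℝ) : ℝ :=
  ∑' k : ℤ, (1 / ω k) * (u k * (u k - Pop ω (Pop ω u) k))

/-- The product of two square-summable sequences is summable. -/
theorem summable_mul_of_summable_sq {ι : Type*} {f g : ι → ℝ}
    (hf : Summable fun k => f k ^ 2) (hg : Summable fun k => g k ^ 2) :
    Summable fun k => f k * g k := by
  refine Summable.of_norm_bounded (hf.add hg) fun k => ?_
  rw [Real.norm_eq_abs, abs_le]
  constructor <;> nlinarith [sq_nonneg (f k + g k), sq_nonneg (f k - g k)]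

theorem summable_sq_add {ι : Type*} {f g : ι → ℝ}
    (hf : Summable fun k => f k ^ 2) (hg : Summable fun k => g k ^ 2) :
    Summable fun k => (f k + g k) ^ 2 := by
  refine ((hf.add ((summable_mul_of_summable_sq hf hg).mul_left 2)).add hg).congr fun k => ?_
  ring

theorem summable_sq_const_mul {ι : Type*} {f : ι → ℝ} (c : ℝ)
    (hf : Summable fun k => f k ^ 2) : Summable fun k => (c * f k) ^ 2 :=
  (hf.mul_left (c ^ 2)).congr fun k => by ring

theorem summable_comp_add_int {h : ℤ → ℝ} (hh : Summable h) (a : ℤ) :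
    Summable fun k => h (k + a) :=
  (Equiv.addRight a).summable_iff.mpr hh

theorem hasSum_telescope_int {h : ℤ → ℝ} (hh : Summable h) :
    HasSum (fun k => h (k + 1) - h k) 0 := by
  have shifted : HasSum (fun k => h (k + 1)) (∑' k, h k) :=
    (Equiv.addRight (1 : ℤ)).hasSum_iff.mpr hh.hasSum
  simpa using shifted.sub hh.hasSum

theorem summable_sq_gradient {u : ℤ → ℝ} (hu : Summable fun k => u k ^ 2) :
    Summable fun k => (u (k + 1) - u k) ^ 2 :=
  (summable_sq_add (summable_comp_add_int hu 1) (summable_sq_const_mul (-1) hu)).congr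
    fun k => by ring

theorem summable_sq_laplacian {u : ℤ → ℝ} (hu : Summable fun k => u k ^ 2) :
    Summable fun k => (u (k + 1) - 2 * u k + u (k - 1)) ^ 2 :=
  (summable_sq_add (summable_sq_add (summable_comp_add_int hu 1)
    (summable_sq_const_mul (-2) hu)) (summable_comp_add_int hu (-1))).congr
    fun k => by simp only [← sub_eq_add_neg]; ring

/-- Summation by parts on `ℤ` for square-summable sequences. -/
theorem hasSum_mul_laplacian {f g : ℤ → ℝ}
    (hf : Summable fun k => f k ^ 2) (hg : Summable fun k => g k ^ 2) :
    HasSum (fun k => f k * (g (k + 1) - 2 * g k + g (k - 1)))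
      (-∑' k, (f (k + 1) - f k) * (g (k + 1) - g k)) := by
  have grad := summable_mul_of_summable_sq (summable_sq_gradient hf) (summable_sq_gradient hg)
  have boundary : Summable fun k => f k * g k - f k * g (k + -1) :=
    (summable_mul_of_summable_sq hf hg).sub
      (summable_mul_of_summable_sq hf (summable_comp_add_int hg (-1)))
  have total := (hasSum_telescope_int boundary).sub grad.hasSum
  rw [zero_sub] at total
  refine total.congr_fun ?_
  intro k
  simp only [← sub_eq_add_neg, add_sub_cancel_right]
  ring

theorem summable_sq_of_summable_inv_mul_sq {ω u : ℤ → ℝ} (hω : ∀ k, 0 < ω k ∧ ω k ≤ 1 / 2)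
    (hu : Summable fun k => (1 / ω k) * u k ^ 2) : Summable fun k => u k ^ 2 := by
  refine Summable.of_nonneg_of_le (fun k => sq_nonneg _) (fun k => ?_) hu
  have one_le : 1 ≤ 1 / ω k := by
    rw [le_div_iff₀ (hω k).1]
    linarith [(hω k).2]
  nlinarith [sq_nonneg (u k)]

theorem summable_mul_sq_laplacian {ω u : ℤ → ℝ} (hω : ∀ k, 0 < ω k ∧ ω k ≤ 1 / 2)
    (hu : Summable fun k => u k ^ 2) :
    Summable fun k => ω k * (u (k + 1) - 2 * u k + u (k - 1)) ^ 2 := by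
  refine Summable.of_nonneg_of_le (fun k => mul_nonneg (hω k).1.le (sq_nonneg _)) (fun k => ?_)
    ((summable_sq_laplacian hu).mul_left (1 / 2))
  exact mul_le_mul_of_nonneg_right (hω k).2 (sq_nonneg _)

theorem dirichlet2_eq {ω u : ℤ → ℝ} (hω : ∀ k, 0 < ω k ∧ ω k ≤ 1 / 2)
    (hu : Summable fun k => u k ^ 2) :
    dirichlet2 ω u
      = 2 * (∑' k : ℤ, (u (k + 1) - u k) ^ 2)
        - ∑' k : ℤ, ω k * (u (k + 1) - 2 * u k + u (k - 1)) ^ 2 := by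
  set w : ℤ → ℝ := fun k => ω k * (u (k + 1) - 2 * u k + u (k - 1)) with w_def
  have hw : Summable fun k => w k ^ 2 := by
    refine Summable.of_nonneg_of_le (fun k => sq_nonneg _) (fun k => ?_)
      (summable_sq_laplacian hu)
    rw [w_def, mul_pow]
    refine mul_le_of_le_one_left (sq_nonneg _) ?_
    nlinarith [(hω k).1, (hω k).2]
  have symm_form : ∑' k, (u (k + 1) - u k) * (w (k + 1) - w k)
      = -∑' k : ℤ, ω k * (u (k + 1) - 2 * u k + u (k - 1)) ^ 2 := by
    have by_parts := (hasSum_mul_laplacian hw hu).tsum_eq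
    rw [← neg_eq_iff_eq_neg]
    simp only [mul_comm (u _ - u _)]
    rw [← by_parts]
    exact tsum_congr fun k => by rw [w_def]; ring
  have total := ((hasSum_mul_laplacian hu hu).mul_left (-2)).sub (hasSum_mul_laplacian hu hw)
  have expand : ∀ k, (1 / ω k) * (u k * (u k - Pop ω (Pop ω u) k))
      = -2 * (u k * (u (k + 1) - 2 * u k + u (k - 1)))
        - u k * (w (k + 1) - 2 * w k + w (k - 1)) := by
    intro k
    have ne_zero := (hω k).1.ne'
    simp only [Pop, w_def, add_sub_cancel_right, sub_add_cancel]
    field_simp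
    ring
  rw [dirichlet2, tsum_congr expand, total.tsum_eq, symm_form]
  simp only [pow_two]
  ring

/-- **Identity and monotonicity of the Dirichlet form.**  For all `u ∈ L²(π)`:
`ℰ₂(u,u) = 2‖∇u‖²_{L²} - Σ_k ω_k (Δu(k))²`; consequently, with `ℰ̃₂` the Dirichlet form
of the homogeneous environment `ω̃_k ≡ 1/2`, one has `ℰ̃₂(u,u) ≤ ℰ₂(u,u)`. -/
theorem dirichlet_form_identity_and_monotonicity
    (ω : ℤ → ℝ) (hω : ∀ k : ℤ, 0 < ω k ∧ ω k ≤ 1 / 2)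
    (u : ℤ → ℝ) (hu : Summable (fun k : ℤ => (1 / ω k) * u k ^ 2)) :
    dirichlet2 ω u
      = 2 * (∑' k : ℤ, (u (k + 1) - u k) ^ 2)
        - (∑' k : ℤ, ω k * (u (k + 1) - 2 * u k + u (k - 1)) ^ 2)
    ∧ dirichlet2 (fun _ : ℤ => (1 : ℝ) / 2) u ≤ dirichlet2 ω u := by
  have sq := summable_sq_of_summable_inv_mul_sq hω hu
  have homogeneous : ∀ _ : ℤ, (0 : ℝ) < 1 / 2 ∧ (1 : ℝ) / 2 ≤ 1 / 2 := fun _ => by norm_num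
  refine ⟨dirichlet2_eq hω sq, ?_⟩
  rw [dirichlet2_eq hω sq, dirichlet2_eq homogeneous sq]
  refine sub_le_sub_left ?_ _
  exact (summable_mul_sq_laplacian hω sq).tsum_le_tsum
    (fun k => mul_le_mul_of_nonneg_right (hω k).2 (sq_nonneg _))
    (summable_mul_sq_laplacian homogeneous sq)
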